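/- arXiv:2303.02526 — 8 statements merged into one kernel-verified Lean document; each statement's English description precedes it below -/
import Mathlib

section
/- Let n ∈ ℕ with n ≥ 1 and let r ∈ ℕ with r ≤ 1. Then every sequence of firing moves (with marked face f₀) starting from the pulse K(n,r) is finite, and every stable configuration reachable from K(n,r) equals the Aztec diamond Az(n). -/
/-- Manhattan distance between faces of the grid. -/
def gdist (f g : ℤ × ℤ) : ℤ := |f.1 - g.1| + |f.2 - g.2|

/-- The marked face. -/
def f₀ : ℤ × ℤ := (0, 0)

/-- The Aztec diamond configuration `Az(n)`. -/
def Az (n : ℕ) : ℤ × ℤ → ℤ :=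
  fun f => if f = f₀ then (n : ℤ) else max ((n : ℤ) - gdist f₀ f + 1) 0

/-- The pulse `K(n,r)`: value `n` within Manhattan distance `r` of `f₀`, `0` elsewhere. -/
def pulse (n r : ℕ) : ℤ × ℤ → ℤ :=
  fun f => if gdist f₀ f ≤ (r : ℤ) then (n : ℤ) else 0

/-- A single firing move with marked face `f₀`. -/
def Fire (n : ℕ) (K K' : ℤ × ℤ → ℤ) : Prop :=
  (∃ f g : ℤ × ℤ, gdist f g = 1 ∧ f ≠ f₀ ∧ g ≠ f₀ ∧ K g + 2 ≤ K f ∧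
      K' = Function.update (Function.update K f (K f - 1)) g (K g + 1)) ∨
  (∃ f : ℤ × ℤ, gdist f f₀ = 1 ∧ K f < (n : ℤ) ∧
      K' = Function.update K f (K f + 1)) ∨
  (∃ f : ℤ × ℤ, gdist f f₀ = 1 ∧ (n : ℤ) < K f ∧
      K' = Function.update K f (K f - 1))

/-- `K'` is reachable from `K` by firing moves. -/
def Reaches (n : ℕ) (K K' : ℤ × ℤ → ℤ) : Prop :=
  Relation.ReflTransGen (Fire n) K K'

/-- A configuration is stable if no firing move applies. -/
def Stable (n : ℕ) (K : ℤ × ℤ → ℤ) : Prop := ∀ K', ¬ Fire n K K'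

theorem gdist_comm (f g : ℤ × ℤ) : gdist f g = gdist g f := by
  simp only [gdist, abs_eq_max_neg]
  omega

theorem gdist_triangle (f g h : ℤ × ℤ) : gdist f h ≤ gdist f g + gdist g h := by
  simp only [gdist, abs_eq_max_neg]
  omega

theorem gdist_f₀_pos {f : ℤ × ℤ} (hf : f ≠ f₀) : 1 ≤ gdist f₀ f := by
  obtain ⟨a, b⟩ := f
  simp only [f₀, ne_eq, Prod.mk.injEq] at hf
  simp only [gdist, f₀, abs_eq_max_neg]
  omega

theorem ne_of_gdist_eq_one {f g : ℤ × ℤ} (h : gdist f g = 1) : f ≠ g := by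
  rintro rfl
  simp [gdist] at h

/-- A face at distance `d + 2` from the marked face has a neighbour at distance `d + 1`. -/
theorem exists_closer_neighbour {f : ℤ × ℤ} {d : ℕ} (hf : gdist f₀ f = d + 2) :
    ∃ g, gdist f₀ g = d + 1 ∧ gdist g f = 1 := by
  obtain ⟨a, b⟩ := f
  simp only [gdist, f₀, abs_eq_max_neg] at hf ⊢
  rcases lt_trichotomy a 0 with ha | ha | ha
  · exact ⟨(a + 1, b), by simp only; omega, by simp only; omega⟩
  · rcases le_or_gt b 0 with hb | hb
    · exact ⟨(a, b + 1), by simp only; omega, by simp only; omega⟩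
    · exact ⟨(a, b - 1), by simp only; omega, by simp only; omega⟩
  · exact ⟨(a - 1, b), by simp only; omega, by simp only; omega⟩

theorem Az_of_ne (n : ℕ) {f : ℤ × ℤ} (hf : f ≠ f₀) :
    Az n f = max ((n : ℤ) - gdist f₀ f + 1) 0 := by
  simp [Az, hf]

/-- Configurations lying between `0` and the Aztec diamond, with the marked value `n`. -/
def BelowAz (n : ℕ) (K : ℤ × ℤ → ℤ) : Prop :=
  K f₀ = n ∧ ∀ f, 0 ≤ K f ∧ K f ≤ Az n f

theorem belowAz_pulse {n r : ℕ} (hr : r ≤ 1) : BelowAz n (pulse n r) := by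
  refine ⟨by simp [pulse, gdist], fun f => ?_⟩
  by_cases hf : f = f₀
  · subst hf
    simp [pulse, gdist, Az]
  · rw [Az_of_ne n hf]
    have := gdist_f₀_pos hf
    simp only [pulse]
    split_ifs <;> omega

theorem BelowAz.le_of_adjacent {n : ℕ} {K : ℤ × ℤ → ℤ} (hK : BelowAz n K) {f : ℤ × ℤ}
    (hf : gdist f f₀ = 1) : K f ≤ n := by
  have h := (hK.2 f).2
  rw [Az_of_ne n (ne_of_gdist_eq_one hf), gdist_comm, hf] at h
  omega

theorem BelowAz.fire {n : ℕ} {K K' : ℤ × ℤ → ℤ} (hK : BelowAz n K) (h : Fire n K K') :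
    BelowAz n K' := by
  rcases h with ⟨f, g, hfg, hf, hg, hlt, rfl⟩ | ⟨f, hf, hlt, rfl⟩ | ⟨f, hf, hlt, rfl⟩
  · refine ⟨by simp [Function.update_of_ne hf.symm, Function.update_of_ne hg.symm, hK.1], ?_⟩
    intro x
    have hKf := hK.2 f
    have hKg := hK.2 g
    rcases eq_or_ne x g with rfl | hxg
    · have ht := gdist_triangle f₀ f x
      rw [Az_of_ne n hf] at hKf
      rw [Az_of_ne n hg] at hKg ⊢
      simp only [Function.update_self]
      omega
    · rw [Function.update_of_ne hxg]
      rcases eq_or_ne x f with rfl | hxf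
      · simp only [Function.update_self]
        omega
      · rw [Function.update_of_ne hxf]
        exact hK.2 x
  · have hf₀ := ne_of_gdist_eq_one hf
    refine ⟨by simp [Function.update_of_ne hf₀.symm, hK.1], fun x => ?_⟩
    rcases eq_or_ne x f with rfl | hxf
    · have := hK.2 x
      rw [Az_of_ne n hf₀, gdist_comm, hf] at this ⊢
      simp only [Function.update_self]
      omega
    · rw [Function.update_of_ne hxf]
      exact hK.2 x
  · exact absurd (hK.le_of_adjacent hf) (not_le.mpr hlt)

theorem BelowAz.reaches {n : ℕ} {K K' : ℤ × ℤ → ℤ} (hK : BelowAz n K) (h : Reaches n K K') :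
    BelowAz n K' := by
  induction h with
  | refl => exact hK
  | tail _ h ih => exact ih.fire h

/-- A square containing the support of `Az n`. -/
noncomputable def azBox (n : ℕ) : Finset (ℤ × ℤ) := Finset.Icc (-n : ℤ) n ×ˢ Finset.Icc (-n : ℤ) n

theorem mem_azBox_of_Az_pos {n : ℕ} {f : ℤ × ℤ} (h : 0 < Az n f) : f ∈ azBox n := by
  obtain ⟨a, b⟩ := f
  simp only [azBox, Finset.mem_product, Finset.mem_Icc]
  by_cases hf : (a, b) = f₀
  · simp only [f₀, Prod.mk.injEq] at hf
    omega
  · rw [Az_of_ne n hf] at h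
    simp only [gdist, f₀, abs_eq_max_neg] at h
    omega

/-- The squared distance to the constant configuration `n`, a quantity decreased by firing. -/
noncomputable def azEnergy (n : ℕ) (K : ℤ × ℤ → ℤ) : ℤ := ∑ f ∈ azBox n, (K f - n) ^ 2

theorem azEnergy_nonneg (n : ℕ) (K : ℤ × ℤ → ℤ) : 0 ≤ azEnergy n K :=
  Finset.sum_nonneg fun _ _ => sq_nonneg _

theorem azEnergy_update {n : ℕ} (K : ℤ × ℤ → ℤ) {f : ℤ × ℤ} (hf : f ∈ azBox n) (v : ℤ) :
    azEnergy n (Function.update K f v) = azEnergy n K - (K f - n) ^ 2 + (v - n) ^ 2 := by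
  unfold azEnergy
  rw [← Finset.add_sum_erase _ _ hf, ← Finset.add_sum_erase _ (fun x => (K x - n) ^ 2) hf,
    Function.update_self, Finset.sum_congr rfl fun x hx => by
      rw [Function.update_of_ne (Finset.ne_of_mem_erase hx)]]
  ring

theorem BelowAz.azEnergy_lt {n : ℕ} {K K' : ℤ × ℤ → ℤ} (hK : BelowAz n K) (h : Fire n K K') :
    azEnergy n K' < azEnergy n K := by
  have hK' := hK.fire h
  rcases h with ⟨f, g, hfg, -, -, hlt, rfl⟩ | ⟨f, hf, hlt, rfl⟩ | ⟨f, hf, hlt, rfl⟩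
  · have hKf := hK.2 f
    have hKg := hK.2 g
    have hg := (hK'.2 g).2
    rw [Function.update_self] at hg
    rw [azEnergy_update _ (mem_azBox_of_Az_pos (by omega)),
      azEnergy_update _ (mem_azBox_of_Az_pos (by omega)),
      Function.update_of_ne (ne_of_gdist_eq_one hfg).symm]
    nlinarith
  · have hKf := hK.2 f
    have hf' := (hK'.2 f).2
    rw [Function.update_self] at hf'
    rw [azEnergy_update _ (mem_azBox_of_Az_pos (by omega))]
    nlinarith
  · exact absurd (hK.le_of_adjacent hf) (not_le.mpr hlt)

theorem BelowAz.not_exists_infinite_firing {n : ℕ} {K : ℤ × ℤ → ℤ} (hK : BelowAz n K) :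
    ¬ ∃ seq : ℕ → (ℤ × ℤ → ℤ), seq 0 = K ∧ ∀ i : ℕ, Fire n (seq i) (seq (i + 1)) := by
  rintro ⟨seq, h0, hseq⟩
  have hbelow : ∀ i, BelowAz n (seq i) := fun i => by
    induction i with
    | zero => rwa [h0]
    | succ i ih => exact ih.fire (hseq i)
  have hbound : ∀ i : ℕ, azEnergy n (seq i) ≤ azEnergy n (seq 0) - i := fun i => by
    induction i with
    | zero => simp
    | succ i ih =>
      have := (hbelow i).azEnergy_lt (hseq i)
      push_cast
      omega
  have h := hbound ((azEnergy n (seq 0)).toNat + 1)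
  have h1 := azEnergy_nonneg n (seq ((azEnergy n (seq 0)).toNat + 1))
  push_cast at h
  omega

/-- In a stable configuration the values drop by at most one per step away from the faces
adjacent to the marked face. -/
theorem Stable.le_apply {n : ℕ} {K : ℤ × ℤ → ℤ} (hK : Stable n K) (d : ℕ) :
    ∀ f, gdist f₀ f = d + 1 → (n : ℤ) - d ≤ K f := by
  induction d with
  | zero =>
    intro f hf
    by_contra hlt
    exact hK _ (Or.inr (Or.inl ⟨f, by rw [gdist_comm, hf]; simp, by simpa using hlt, rfl⟩))
  | succ d ih =>
    intro f hf
    push_cast at hf ⊢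
    obtain ⟨g, hg, hgf⟩ := exists_closer_neighbour (f := f) (d := d) (by omega)
    have hKg := ih g hg
    have hself : gdist f₀ f₀ = 0 := by simp [gdist]
    have hf₀ : f ≠ f₀ := by rintro rfl; omega
    have hg₀ : g ≠ f₀ := by rintro rfl; omega
    by_contra hlt
    exact hK _ (Or.inl ⟨g, f, hgf, hg₀, hf₀, by omega, rfl⟩)

theorem BelowAz.eq_Az_of_stable {n : ℕ} {K : ℤ × ℤ → ℤ} (hK : BelowAz n K) (hs : Stable n K) :
    K = Az n := by
  funext f
  by_cases hf : f = f₀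
  · subst hf
    simp [hK.1, Az]
  · have h := hK.2 f
    have hpos := gdist_f₀_pos hf
    have hle := hs.le_apply (gdist f₀ f - 1).toNat f (by omega)
    rw [Az_of_ne n hf] at h ⊢
    omega

theorem pulse_radius_le_one_terminates_uniquely_in_Aztec
    (n r : ℕ) (hn : 1 ≤ n) (hr : r ≤ 1) :
    (¬ ∃ seq : ℕ → (ℤ × ℤ → ℤ), seq 0 = pulse n r ∧
        ∀ i : ℕ, Fire n (seq i) (seq (i + 1))) ∧
    (∀ K' : ℤ × ℤ → ℤ, Reaches n (pulse n r) K' → Stable n K' → K' = Az n) :=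
  ⟨(belowAz_pulse hr).not_exists_infinite_firing,
    fun _ hreach hstable => ((belowAz_pulse hr).reaches hreach).eq_Az_of_stable hstable⟩
end

section
/- Let n ∈ ℕ, let K be a configuration, and let f and g be adjacent faces (dist(f,g) = 1), both different from f₀, with dist(f₀,f) < dist(f₀,g) < n. If K f > Az(n) f and K g ≤ Az(n) g, then K f ≥ K g + 2, so one can fire from f to g. Moreover, if K' is the configuration obtained by firing from f to g, then K' f > Az(n) f if and only if K f > Az(n) f + 1, and K' g > Az(n) g if and only if K g = Az(n) g. -/
theorem free_to_fire
    (n : ℕ) (K : ℤ × ℤ → ℤ) (hK : K f₀ = (n : ℤ))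
    (f g : ℤ × ℤ) (hadj : gdist f g = 1) (hf : f ≠ f₀) (hg : g ≠ f₀)
    (hfg : gdist f₀ f < gdist f₀ g) (hgn : gdist f₀ g < (n : ℤ))
    (hvf : Az n f < K f) (hvg : K g ≤ Az n g) :
    K g + 2 ≤ K f ∧
    ((Function.update (Function.update K f (K f - 1)) g (K g + 1)) f > Az n f ↔
        K f > Az n f + 1) ∧
    ((Function.update (Function.update K f (K f - 1)) g (K g + 1)) g > Az n g ↔
        K g = Az n g) := by
  have hne : f ≠ g := by
    rintro rfl
    exact lt_irrefl _ hfg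
  simp only [Function.update_self, Function.update_of_ne hne]
  simp only [Az, if_neg hf] at hvf ⊢
  simp only [if_neg hg, Az] at hvg ⊢
  omega
end

section
/- (Flooding Lemma) Let n ∈ ℕ and let K be a configuration with K f₀ = n, nonnegative values, and finite support. Let f be a face with K f > Az(n) f > 0 such that every face h with dist(f₀,h) > dist(f₀,f) satisfies K h ≤ Az(n) h. Then there exist a configuration K' reachable from K by firing moves and a face g with dist(f₀,g) = dist(f₀,f) + 1 and K' g > Az(n) g. -/
/-- If filling `x` up to level `m` disturbs only faces strictly closer to `f₀`, then a neighbour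
`y` of `x` in the next layer can be filled up to level `m - 1`. -/
theorem exists_reaches_fill_adjacent {n : ℕ} {d m : ℤ} {x y : ℤ × ℤ} (hd : 0 < d)
    (hx : gdist f₀ x = d) (hy : gdist f₀ y = d + 1) (hxy : gdist x y = 1)
    (fill : ∀ K : ℤ × ℤ → ℤ, ∃ K' : ℤ × ℤ → ℤ, Reaches n K K' ∧ m ≤ K' x ∧
      ∀ z, d ≤ gdist f₀ z → z ≠ x → K' z = K z)
    (K : ℤ × ℤ → ℤ) :
    ∃ K' : ℤ × ℤ → ℤ, Reaches n K K' ∧ m - 1 ≤ K' y ∧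
      ∀ z, d ≤ gdist f₀ z → z ≠ x → z ≠ y → K' z = K z := by
  have hx₀ : x ≠ f₀ := by rintro rfl; simp [gdist] at hx; omega
  have hy₀ : y ≠ f₀ := by rintro rfl; simp [gdist] at hy; omega
  have hne : y ≠ x := by rintro rfl; omega
  induction hk : (m - 1 - K y).toNat generalizing K with
  | zero => exact ⟨K, .refl, by omega, fun _ _ _ _ => rfl⟩
  | succ k ih =>
    obtain ⟨K₁, hr₁, hm₁, hK₁⟩ := fill K
    have hy₁ : K₁ y = K y := hK₁ y (by omega) hne
    obtain ⟨K₂, hr₂, hm₂, hK₂⟩ :=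
      ih (Function.update (Function.update K₁ x (K₁ x - 1)) y (K₁ y + 1))
        (by rw [Function.update_self]; omega)
    refine ⟨K₂, (hr₁.tail ?_).trans hr₂, hm₂, fun z hz hzx hzy => ?_⟩
    · exact Or.inl ⟨x, y, hxy, hx₀, hy₀, by omega, rfl⟩
    · rw [hK₂ z hz hzx hzy, Function.update_of_ne hzy, Function.update_of_ne hzx, hK₁ z hz hzx]

/-- A neighbour of `f₀` can be filled up to level `n` without changing any other face. -/
theorem exists_reaches_fill_of_gdist_eq_one {n : ℕ} {x : ℤ × ℤ} (hx : gdist f₀ x = 1)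
    (K : ℤ × ℤ → ℤ) :
    ∃ K' : ℤ × ℤ → ℤ, Reaches n K K' ∧ (n : ℤ) ≤ K' x ∧ ∀ z, z ≠ x → K' z = K z := by
  induction hk : ((n : ℤ) - K x).toNat generalizing K with
  | zero => exact ⟨K, .refl, by omega, fun _ _ => rfl⟩
  | succ k ih =>
    obtain ⟨K', hr, hn, hK'⟩ := ih (Function.update K x (K x + 1))
      (by rw [Function.update_self]; omega)
    refine ⟨K', .head ?_ hr, hn, fun z hz => ?_⟩
    · exact Or.inr (Or.inl ⟨x, by rw [gdist_comm, hx], by omega, rfl⟩)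
    · rw [hK' z hz, Function.update_of_ne hz]

theorem exists_adjacent_closer {d : ℕ} {y : ℤ × ℤ} (hy : gdist f₀ y = d + 1) :
    ∃ x, gdist f₀ x = d ∧ gdist x y = 1 := by
  obtain ⟨a, b⟩ := y
  simp only [gdist, f₀, abs_eq_max_neg] at hy
  rcases lt_trichotomy a 0 with ha | ha | ha
  · exact ⟨(a + 1, b), by simp only [gdist, f₀, abs_eq_max_neg]; omega, by simp [gdist]⟩
  · rcases lt_trichotomy b 0 with hb | hb | hb
    · exact ⟨(a, b + 1), by simp only [gdist, f₀, abs_eq_max_neg]; omega, by simp [gdist]⟩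
    · simp [ha, hb] at hy; omega
    · exact ⟨(a, b - 1), by simp only [gdist, f₀, abs_eq_max_neg]; omega, by simp [gdist]⟩
  · exact ⟨(a - 1, b), by simp only [gdist, f₀, abs_eq_max_neg]; omega, by simp [gdist]⟩

/-- Any face at distance `d + 1` from `f₀` can be filled up to its Aztec diamond level, changing
otherwise only faces strictly closer to `f₀`. -/
theorem exists_reaches_fill (n d : ℕ) {x : ℤ × ℤ} (hx : gdist f₀ x = d + 1)
    (K : ℤ × ℤ → ℤ) :
    ∃ K' : ℤ × ℤ → ℤ, Reaches n K K' ∧ (n : ℤ) - d ≤ K' x ∧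
      ∀ z, (d : ℤ) + 1 ≤ gdist f₀ z → z ≠ x → K' z = K z := by
  induction d generalizing x K with
  | zero =>
    obtain ⟨K', hr, hn, hK'⟩ :=
      exists_reaches_fill_of_gdist_eq_one (n := n) (by simpa using hx) K
    exact ⟨K', hr, by simpa using hn, fun z _ => hK' z⟩
  | succ d ih =>
    obtain ⟨w, hw, hwx⟩ := exists_adjacent_closer hx
    push_cast at hx hw ⊢
    obtain ⟨K', hr, hn, hK'⟩ :=
      exists_reaches_fill_adjacent (by omega) hw hx hwx (fun K => ih hw K) K
    refine ⟨K', hr, by omega, fun z hz hzx => hK' z (by omega) ?_ hzx⟩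
    rintro rfl
    omega

/-- Every face other than `f₀` has a neighbour in the next layer that is also adjacent to a
second face of the same layer. -/
theorem exists_adjacent_farther {f : ℤ × ℤ} (hf : f ≠ f₀) :
    ∃ x g, x ≠ f ∧ gdist f₀ x = gdist f₀ f ∧ gdist f₀ g = gdist f₀ f + 1 ∧
      gdist f g = 1 ∧ gdist x g = 1 := by
  obtain ⟨a, b⟩ := f
  rcases lt_trichotomy b 0 with hb | hb | hb
  · rcases lt_or_ge a 0 with ha | ha
    · exact ⟨(a - 1, b + 1), (a - 1, b), by simp, by simp only [gdist, f₀, abs_eq_max_neg]; omega,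
        by simp only [gdist, f₀, abs_eq_max_neg]; omega, by simp [gdist], by simp [gdist]⟩
    · exact ⟨(a + 1, b + 1), (a + 1, b), by simp, by simp only [gdist, f₀, abs_eq_max_neg]; omega,
        by simp only [gdist, f₀, abs_eq_max_neg]; omega, by simp [gdist], by simp [gdist]⟩
  · subst hb
    rcases lt_trichotomy a 0 with ha | ha | ha
    · exact ⟨(a + 1, 1), (a, 1), by simp, by simp only [gdist, f₀, abs_eq_max_neg]; omega,
        by simp only [gdist, f₀, abs_eq_max_neg]; omega, by simp [gdist], by simp [gdist]⟩
    · exact absurd (by rw [ha]; rfl) hf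
    · exact ⟨(a - 1, 1), (a, 1), by simp, by simp only [gdist, f₀, abs_eq_max_neg]; omega,
        by simp only [gdist, f₀, abs_eq_max_neg]; omega, by simp [gdist], by simp [gdist]⟩
  · rcases lt_or_ge a 0 with ha | ha
    · exact ⟨(a - 1, b - 1), (a - 1, b), by simp, by simp only [gdist, f₀, abs_eq_max_neg]; omega,
        by simp only [gdist, f₀, abs_eq_max_neg]; omega, by simp [gdist], by simp [gdist]⟩
    · exact ⟨(a + 1, b - 1), (a + 1, b), by simp, by simp only [gdist, f₀, abs_eq_max_neg]; omega,
        by simp only [gdist, f₀, abs_eq_max_neg]; omega, by simp [gdist], by simp [gdist]⟩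

theorem gdist_pos {f g : ℤ × ℤ} (h : f ≠ g) : 0 < gdist f g := by
  by_contra! hle
  apply h
  simp only [gdist] at hle
  ext <;> grind

theorem flooding_lemma
    (n : ℕ) (K : ℤ × ℤ → ℤ) (hK : K f₀ = (n : ℤ))
    (hnonneg : ∀ f : ℤ × ℤ, 0 ≤ K f)
    (hfin : (Function.support K).Finite)
    (f : ℤ × ℤ) (hviol : Az n f < K f) (hpos : 0 < Az n f)
    (hmax : ∀ h : ℤ × ℤ, gdist f₀ f < gdist f₀ h → K h ≤ Az n h) :
    ∃ (K' : ℤ × ℤ → ℤ) (g : ℤ × ℤ), Reaches n K K' ∧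
      gdist f₀ g = gdist f₀ f + 1 ∧ Az n g < K' g := by
  have hf : f ≠ f₀ := by
    rintro rfl
    simp [Az, hK] at hviol
  have hdpos : 0 < gdist f₀ f := gdist_pos hf.symm
  obtain ⟨x, g, hxf, hx, hg, hfg, hxg⟩ := exists_adjacent_farther hf
  have hg₀ : g ≠ f₀ := by rintro rfl; simp [gdist] at hg hdpos; omega
  have hgf : g ≠ f := by rintro rfl; omega
  obtain ⟨d, hd⟩ : ∃ d : ℕ, gdist f₀ f = d + 1 := ⟨(gdist f₀ f - 1).toNat, by omega⟩
  simp only [Az, if_neg hf] at hviol hpos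
  have hAz : Az n g = n - d - 1 := by
    simp only [Az, if_neg hg₀]
    omega
  obtain ⟨K₁, hr, hn, hK₁⟩ := exists_reaches_fill_adjacent (by omega) (hx.trans hd)
    (by omega) hxg (fun K => exists_reaches_fill n d (hx.trans hd) K) K
  have hf₁ : K₁ f = K f := hK₁ f (by omega) hxf.symm hgf.symm
  rcases hn.eq_or_lt with hn | hn
  · refine ⟨_, g, hr.tail (Or.inl ⟨f, g, hfg, hf, hg₀, by omega, rfl⟩), hg, ?_⟩
    rw [Function.update_self]
    omega
  · exact ⟨K₁, g, hr, hg, by omega⟩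
end

section
/- Let n, r ∈ ℕ with n ≥ 1 and r ≥ ⌈n/√3⌉ + 1 (where ⌈n/√3⌉ is the ceiling of the real number n/√3). Then the Aztec diamond Az(n) is not reachable from the pulse K(n,r) by firing moves; in particular, firing from K(n,r) can never terminate in Az(n). -/
/-- The faces at distance at most `k` from `f₀`, split by the parity of `k - (x + y)`: rotating the
grid by 45 degrees turns the ball into a `(k + 1) × (k + 1)` square and a `k × k` square. -/
def gridBall (k : ℕ) : Finset (ℤ × ℤ) :=
  (Finset.range (k + 1) ×ˢ Finset.range (k + 1)).image
      (fun p : ℕ × ℕ => ((p.1 : ℤ) + p.2 - k, (p.1 : ℤ) - p.2)) ∪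
    (Finset.range k ×ˢ Finset.range k).image
      (fun p : ℕ × ℕ => ((p.1 : ℤ) + p.2 - k + 1, (p.1 : ℤ) - p.2))

theorem gdist_f₀ (f : ℤ × ℤ) : gdist f₀ f = |f.1| + |f.2| := by
  simp [gdist, f₀]

theorem mem_gridBall {k : ℕ} {f : ℤ × ℤ} : f ∈ gridBall k ↔ gdist f₀ f ≤ k := by
  obtain ⟨x, y⟩ := f
  simp only [gridBall, gdist_f₀, Finset.mem_union, Finset.mem_image, Finset.mem_product,
    Finset.mem_range, Prod.mk.injEq, Prod.exists]
  have hx := abs_cases x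
  have hy := abs_cases y
  constructor
  · rintro (⟨a, b, ⟨ha, hb⟩, h1, h2⟩ | ⟨a, b, ⟨ha, hb⟩, h1, h2⟩) <;> omega
  · intro h
    rcases Int.emod_two_eq_zero_or_one (x + y + k) with he | ho
    · exact Or.inl ⟨((x + y + k) / 2).toNat, ((x - y + k) / 2).toNat, by omega⟩
    · exact Or.inr ⟨((x + y + k - 1) / 2).toNat, ((x - y + k - 1) / 2).toNat, by omega⟩

theorem card_gridBall (k : ℕ) : (gridBall k).card = 2 * k ^ 2 + 2 * k + 1 := by
  rw [gridBall, Finset.card_union_of_disjoint, Finset.card_image_of_injective,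
    Finset.card_image_of_injective]
  · simp only [Finset.card_product, Finset.card_range]
    ring
  · rintro ⟨a, b⟩ ⟨c, d⟩ h
    simp only [Prod.mk.injEq] at h ⊢
    omega
  · rintro ⟨a, b⟩ ⟨c, d⟩ h
    simp only [Prod.mk.injEq] at h ⊢
    omega
  · rw [Finset.disjoint_left]
    rintro ⟨x, y⟩ h h'
    simp only [Finset.mem_image, Finset.mem_product, Finset.mem_range, Prod.mk.injEq,
      Prod.exists] at h h'
    obtain ⟨a, b, -, h1, h2⟩ := h
    obtain ⟨c, d, -, h3, h4⟩ := h'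
    omega

theorem sum_ite_gdist_le {S : Finset (ℤ × ℤ)} {k : ℕ} (hS : gridBall k ⊆ S) :
    ∑ f ∈ S, (if gdist f₀ f ≤ k then (1 : ℤ) else 0) = 2 * k ^ 2 + 2 * k + 1 := by
  have h : S.filter (fun f => gdist f₀ f ≤ k) = gridBall k := by
    ext f
    rw [Finset.mem_filter, ← mem_gridBall]
    exact ⟨fun h => h.2, fun h => ⟨hS h, h⟩⟩
  rw [Finset.sum_boole, h, card_gridBall]
  push_cast
  ring

theorem sum_pulse {S : Finset (ℤ × ℤ)} {n r : ℕ} (hS : gridBall r ⊆ S) :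
    ∑ f ∈ S, pulse n r f = n * (2 * r ^ 2 + 2 * r + 1) := by
  rw [← sum_ite_gdist_le hS, Finset.mul_sum]
  exact Finset.sum_congr rfl fun f _ => by simp [pulse]

theorem sum_range_ite_le {d : ℤ} (hd : 0 ≤ d) (m : ℕ) :
    ∑ k ∈ Finset.range m, (if d ≤ (k : ℤ) then (1 : ℤ) else 0) = max ((m : ℤ) - d) 0 := by
  induction m with
  | zero => simpa using hd
  | succ m ih =>
    rw [Finset.sum_range_succ, ih]
    push_cast
    split_ifs <;> omega

theorem Az_eq_sum_sub (n : ℕ) (f : ℤ × ℤ) :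
    Az n f = ∑ k ∈ Finset.range (n + 1), (if gdist f₀ f ≤ (k : ℤ) then (1 : ℤ) else 0) -
      if f = f₀ then 1 else 0 := by
  rw [sum_range_ite_le (by rw [gdist_f₀]; positivity), Az]
  split_ifs with h
  · subst h
    simp [gdist]
    omega
  · push_cast
    omega

theorem three_mul_sum_range_ball (m : ℕ) :
    3 * ∑ k ∈ Finset.range m, (2 * (k : ℤ) ^ 2 + 2 * k + 1) = (m : ℤ) * (2 * m ^ 2 + 1) := by
  induction m with
  | zero => simp
  | succ m ih =>
    rw [Finset.sum_range_succ, mul_add, ih]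
    push_cast
    ring

theorem three_mul_sum_Az {S : Finset (ℤ × ℤ)} {n : ℕ} (hS : gridBall n ⊆ S) :
    3 * ∑ f ∈ S, Az n f = (n : ℤ) * (2 * n ^ 2 + 6 * n + 7) := by
  have h₀ : f₀ ∈ S := hS (mem_gridBall.2 (by simp [gdist]))
  have h : ∑ f ∈ S, Az n f =
      ∑ k ∈ Finset.range (n + 1), (2 * (k : ℤ) ^ 2 + 2 * k + 1) - 1 := by
    simp only [Az_eq_sum_sub, Finset.sum_sub_distrib]
    rw [Finset.sum_comm, Finset.sum_ite_eq' S f₀, if_pos h₀]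
    congr 1
    refine Finset.sum_congr rfl fun k hk => sum_ite_gdist_le fun f hf => hS ?_
    rw [mem_gridBall] at hf ⊢
    rw [Finset.mem_range] at hk
    omega
  rw [h, mul_sub, three_mul_sum_range_ball]
  push_cast
  ring

theorem sum_update_of_mem_eq_add {ι : Type*} [DecidableEq ι] {S : Finset ι} {i : ι} (hi : i ∈ S)
    (K : ι → ℤ) (a : ℤ) : ∑ j ∈ S, Function.update K i (K i + a) j = ∑ j ∈ S, K j + a := by
  rw [Finset.sum_update_of_mem hi, ← Finset.sum_sdiff (Finset.singleton_subset_iff.2 hi),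
    Finset.sum_singleton]
  ring

/-- Configurations bounded by `n` stay bounded by `n` under firing. -/
theorem Fire.le {n : ℕ} {K K' : ℤ × ℤ → ℤ} (h : Fire n K K') (hK : ∀ f, K f ≤ n) (f : ℤ × ℤ) :
    K' f ≤ n := by
  rcases h with ⟨a, b, -, -, -, hab, rfl⟩ | ⟨a, -, ha, rfl⟩ | ⟨a, -, ha, rfl⟩
  · have := hK a
    have := hK f
    simp only [Function.update_apply]
    split_ifs <;> omega
  · have := hK f
    simp only [Function.update_apply]
    split_ifs <;> omega
  · exact absurd (hK a) (not_le.2 ha)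

/-- Firing from a configuration bounded by `n` never decreases the total mass. -/
theorem Fire.exists_sum_le {n : ℕ} {K K' : ℤ × ℤ → ℤ} (h : Fire n K K') (hK : ∀ f, K f ≤ n) :
    ∃ T : Finset (ℤ × ℤ), ∀ S, T ⊆ S → ∑ f ∈ S, K f ≤ ∑ f ∈ S, K' f := by
  rcases h with ⟨a, b, hd, -, -, -, rfl⟩ | ⟨a, -, -, rfl⟩ | ⟨a, -, ha, rfl⟩
  · refine ⟨{a, b}, fun S hS => ?_⟩
    have hba : b ≠ a := by
      rintro rfl
      simp [gdist] at hd
    have hb := sum_update_of_mem_eq_add (hS (by simp : b ∈ ({a, b} : Finset (ℤ × ℤ))))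
      (Function.update K a (K a - 1)) 1
    have ha := sum_update_of_mem_eq_add (hS (by simp : a ∈ ({a, b} : Finset (ℤ × ℤ)))) K (-1)
    rw [Function.update_of_ne hba] at hb
    rw [← sub_eq_add_neg] at ha
    linarith
  · refine ⟨{a}, fun S hS => ?_⟩
    rw [sum_update_of_mem_eq_add (hS (Finset.mem_singleton_self a))]
    linarith
  · exact absurd (hK a) (not_le.2 ha)

theorem Reaches.le_and_exists_sum_le {n : ℕ} {K K' : ℤ × ℤ → ℤ} (h : Reaches n K K')
    (hK : ∀ f, K f ≤ n) :
    (∀ f, K' f ≤ n) ∧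
      ∃ T : Finset (ℤ × ℤ), ∀ S, T ⊆ S → ∑ f ∈ S, K f ≤ ∑ f ∈ S, K' f := by
  induction h with
  | refl => exact ⟨hK, ∅, fun _ _ => le_rfl⟩
  | tail _ hfire ih =>
    obtain ⟨hle, T, hT⟩ := ih
    obtain ⟨T', hT'⟩ := hfire.exists_sum_le hle
    exact ⟨hfire.le hle, T ∪ T', fun S hS =>
      (hT S (Finset.union_subset_left hS)).trans (hT' S (Finset.union_subset_right hS))⟩

theorem exists_sq_le_of_ceil_div_sqrt_three_le {n r : ℕ}
    (hr : ⌈(n : ℝ) / Real.sqrt 3⌉ + 1 ≤ (r : ℤ)) :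
    ∃ t : ℤ, 0 ≤ t ∧ (r : ℤ) = t + 1 ∧ (n : ℤ) ^ 2 ≤ 3 * t ^ 2 := by
  have h3 : 0 < Real.sqrt 3 := Real.sqrt_pos.2 (by norm_num)
  have ht : (n : ℝ) / Real.sqrt 3 ≤ ((r - 1 : ℤ) : ℝ) := Int.ceil_le.1 (by omega)
  have ht0 : (0 : ℝ) ≤ ((r - 1 : ℤ) : ℝ) := le_trans (by positivity) ht
  refine ⟨r - 1, by exact_mod_cast ht0, by ring, ?_⟩
  rw [div_le_iff₀ h3] at ht
  have hsq := pow_le_pow_left₀ (Nat.cast_nonneg n) ht 2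
  rw [mul_pow, Real.sq_sqrt (by norm_num), mul_comm] at hsq
  exact_mod_cast hsq

theorem third_regime_never_aztec
    (n r : ℕ) (hn : 1 ≤ n)
    (hr : ⌈(n : ℝ) / Real.sqrt 3⌉ + 1 ≤ (r : ℤ)) :
    ¬ Reaches n (pulse n r) (Az n) := by
  intro h
  obtain ⟨-, T, hT⟩ := h.le_and_exists_sum_le fun f => by
    rw [pulse]
    split_ifs <;> omega
  have hS := hT (T ∪ (gridBall n ∪ gridBall r)) Finset.subset_union_left
  have hAz := three_mul_sum_Az (S := T ∪ (gridBall n ∪ gridBall r)) (n := n)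
    (Finset.subset_union_left.trans Finset.subset_union_right)
  rw [sum_pulse (Finset.subset_union_right.trans Finset.subset_union_right)] at hS
  obtain ⟨t, ht, hrt, hnt⟩ := exists_sq_le_of_ceil_div_sqrt_three_le hr
  have hn' : (0 : ℤ) < n := by exact_mod_cast hn
  have hle : (n : ℤ) * (3 * (2 * r ^ 2 + 2 * r + 1)) ≤ n * (2 * n ^ 2 + 6 * n + 7) := by
    linarith
  have hle' := le_of_mul_le_mul_left hle hn'
  have hn2t : (n : ℤ) ≤ 2 * t := by nlinarith
  rw [hrt] at hle'
  nlinarith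
end

section
/- Let R be a path configuration of length k whose entries form a weakly decreasing sequence R 1 ≥ R 2 ≥ … ≥ R k. Then every path configuration R' reachable from R by path-firing moves also has weakly decreasing entries R' 1 ≥ R' 2 ≥ … ≥ R' k. -/
/-- A path-firing move on path configurations of length `k` (positions `1,…,k`):
fire from position `i` into an adjacent position `j`. -/
def PFireFrom (k i : ℕ) (R R' : ℕ → ℤ) : Prop :=
  ∃ j : ℕ, 1 ≤ i ∧ i ≤ k ∧ 1 ≤ j ∧ j ≤ k ∧ (i = j + 1 ∨ j = i + 1) ∧
    R j + 2 ≤ R i ∧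
    R' = Function.update (Function.update R i (R i - 1)) j (R j + 1)

/-- A path-firing move on path configurations of length `k`. -/
def PFire (k : ℕ) (R R' : ℕ → ℤ) : Prop := ∃ i : ℕ, PFireFrom k i R R'

/-- `R'` is reachable from `R` by path-firing moves along a path of length `k`. -/
def PReaches (k : ℕ) (R R' : ℕ → ℤ) : Prop := Relation.ReflTransGen (PFire k) R R'

/-- A path configuration is path-stable if no path-firing move applies. -/
def PStable (k : ℕ) (R : ℕ → ℤ) : Prop := ∀ R', ¬ PFire k R R'

theorem path_firing_preserves_decreasing
    (k : ℕ) (R : ℕ → ℤ)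
    (hdec : ∀ i : ℕ, 1 ≤ i → i < k → R (i + 1) ≤ R i)
    (R' : ℕ → ℤ) (h : PReaches k R R') :
    ∀ i : ℕ, 1 ≤ i → i < k → R' (i + 1) ≤ R' i := by
  induction h with
  | refl => exact hdec
  | @tail S T _ hfire ih =>
    obtain ⟨i, j, hi, hik, hj, hjk, hadj, hle, rfl⟩ := hfire
    intro n hn hnk
    have hstep := ih n hn hnk
    rcases hadj with rfl | rfl
    · have := ih j hj (by omega)
      omega
    · simp only [Function.update_apply]
      split_ifs <;> subst_vars <;> omega
end

section
/- Let R be a path configuration of length k whose entries are weakly decreasing, and suppose R' is obtained from R by a finite sequence of path-firing moves. If there is an index i with 2 ≤ i and i + 3 ≤ k such that R'_{i−1} > R'_i = R'_{i+1} = R'_{i+2} > R'_{i+3}, then no move in the firing sequence fires from position i, position i+1, or position i+2. -/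
/-- From a weakly decreasing configuration, position `p` can only fire into `p + 1`. -/
theorem PFireFrom.eq_right {k p : ℕ} {S S' : ℕ → ℤ}
    (hdec : ∀ a : ℕ, 1 ≤ a → a < k → S (a + 1) ≤ S a) (h : PFireFrom k p S S') :
    1 ≤ p ∧ p < k ∧ S (p + 1) + 2 ≤ S p ∧ S' p = S p - 1 ∧ S' (p + 1) = S (p + 1) + 1 ∧
      ∀ q, q ≠ p → q ≠ p + 1 → S' q = S q := by
  obtain ⟨j, hp, hpk, hj, hjk, hpj | hpj, hle, rfl⟩ := h
  · subst hpj
    have := hdec j hj (by omega)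
    omega
  · subst hpj
    refine ⟨hp, by omega, hle, by simp, by simp, fun q hq hq' => ?_⟩
    simp [hq, hq']

/-- Path-firing moves preserve weakly decreasing configurations. -/
theorem PFire.decreasing {k : ℕ} {S S' : ℕ → ℤ}
    (hdec : ∀ a : ℕ, 1 ≤ a → a < k → S (a + 1) ≤ S a) (h : PFire k S S') :
    ∀ a : ℕ, 1 ≤ a → a < k → S' (a + 1) ≤ S' a := by
  obtain ⟨p, h⟩ := h
  obtain ⟨hp, hpk, hle, e1, e2, e3⟩ := h.eq_right hdec
  intro a ha hak
  have := hdec a ha hak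
  grind

/-- If a move from a weakly decreasing configuration ends with three equal entries at
`i, i + 1, i + 2`, it does not fire from any of them, and these entries were already equal. -/
theorem PFireFrom.of_triple_eq {k p i : ℕ} {S S' : ℕ → ℤ}
    (hdec : ∀ a : ℕ, 1 ≤ a → a < k → S (a + 1) ≤ S a) (h : PFireFrom k p S S')
    (hi : 1 ≤ i) (hik : i + 2 ≤ k) (h2 : S' i = S' (i + 1)) (h3 : S' (i + 1) = S' (i + 2)) :
    ¬ (p = i ∨ p = i + 1 ∨ p = i + 2) ∧ S i = S (i + 1) ∧ S (i + 1) = S (i + 2) := by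
  obtain ⟨hp, hpk, hle, e1, e2, e3⟩ := h.eq_right hdec
  have d1 := hdec i hi (by omega)
  have d2 : S (i + 2) ≤ S (i + 1) := hdec (i + 1) (by omega) (by omega)
  grind

theorem no_adjacent_triple
    (k : ℕ) (R : ℕ → ℤ)
    (hdec : ∀ a : ℕ, 1 ≤ a → a < k → R (a + 1) ≤ R a)
    (m : ℕ) (seq : ℕ → ℕ → ℤ) (h0 : seq 0 = R)
    (hstep : ∀ t : ℕ, t < m → PFire k (seq t) (seq (t + 1)))
    (i : ℕ) (hi : 2 ≤ i) (hik : i + 3 ≤ k)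
    (h1 : seq m i < seq m (i - 1))
    (h2 : seq m i = seq m (i + 1))
    (h3 : seq m (i + 1) = seq m (i + 2))
    (h4 : seq m (i + 3) < seq m (i + 2)) :
    ∀ t : ℕ, t < m → ∀ p : ℕ, (p = i ∨ p = i + 1 ∨ p = i + 2) →
      ¬ PFireFrom k p (seq t) (seq (t + 1)) := by
  have dec : ∀ t, t ≤ m → ∀ a : ℕ, 1 ≤ a → a < k → seq t (a + 1) ≤ seq t a := by
    intro t
    induction t with
    | zero => exact fun _ => h0 ▸ hdec
    | succ t ih => exact fun ht => (hstep t ht).decreasing (ih (by omega))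
  have triple : ∀ t, t ≤ m → seq t i = seq t (i + 1) ∧ seq t (i + 1) = seq t (i + 2) := by
    intro t ht
    induction ht using Nat.decreasingInduction with
    | self => exact ⟨h2, h3⟩
    | of_succ t ht ih =>
      obtain ⟨p, hp⟩ := hstep t ht
      exact (hp.of_triple_eq (dec t ht.le) (by omega) (by omega) ih.1 ih.2).2
  intro t ht p hp hfire
  obtain ⟨e1, e2⟩ := triple (t + 1) ht
  exact (hfire.of_triple_eq (dec t ht.le) (by omega) (by omega) e1 e2).1 hp
end

section
/- Let n, ℓ ∈ ℕ with n ≥ 2 and ℓ ≥ 1, and let R' be a path-stable configuration reachable from R(ℓ) by path-firing moves. Then for every position i, R'_i = n if and only if i ≤ ℓ − ⌊n/2⌋ (where the inequality is in ℤ; in particular, if ℓ ≤ ⌊n/2⌋ then no entry of R' equals n). -/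
/-- The length of the path `𝒫(ℓ)`: `ℓ + (n − ⌈n/2⌉)`. -/
def pathLen (n ℓ : ℕ) : ℕ := ℓ + (n - (n + 1) / 2)

/-- The initial path configuration `R(ℓ)`: the first `ℓ` entries equal `n`,
the remaining `n − ⌈n/2⌉` entries equal `0`. -/
def Rinit (n ℓ : ℕ) : ℕ → ℤ :=
  fun i => if 1 ≤ i ∧ i ≤ ℓ then (n : ℤ) else 0

/-- The sum of the first `k` entries of a path configuration. -/
def prefixSum (R : ℕ → ℤ) (k : ℕ) : ℤ := ∑ t ∈ Finset.range k, R (t + 1)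

theorem prefixSum_zero (R : ℕ → ℤ) : prefixSum R 0 = 0 := by simp [prefixSum]

theorem prefixSum_succ (R : ℕ → ℤ) (k : ℕ) :
    prefixSum R (k + 1) = prefixSum R k + R (k + 1) := by
  simp [prefixSum, Finset.sum_range_succ]

/-- The entries at positions `1, …, k` are weakly decreasing. -/
def PDecreasing (k : ℕ) (R : ℕ → ℤ) : Prop := ∀ i, 1 ≤ i → i + 1 ≤ k → R (i + 1) ≤ R i

theorem PDecreasing.le {k : ℕ} {R : ℕ → ℤ} (h : PDecreasing k R) {i j : ℕ} (hi : 1 ≤ i)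
    (hij : i ≤ j) (hj : j ≤ k) : R j ≤ R i := by
  induction j, hij using Nat.le_induction with
  | base => exact le_rfl
  | succ j hij ih => exact (h j (by omega) hj).trans (ih (by omega))

theorem PFire.exists_right {k : ℕ} {R R' : ℕ → ℤ} (h : PFire k R R') (hR : PDecreasing k R) :
    ∃ i, 1 ≤ i ∧ i + 1 ≤ k ∧ R (i + 1) + 2 ≤ R i ∧
      ∀ t, R' t = R t - (if t = i then 1 else 0) + (if t = i + 1 then 1 else 0) := by
  obtain ⟨i, j, hi, hik, hj, hjk, rfl | rfl, hle, rfl⟩ := h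
  · have := hR j hj hik
    omega
  · refine ⟨i, hi, hjk, hle, fun t => ?_⟩
    simp only [Function.update_apply]
    split_ifs <;> subst_vars <;> omega

theorem prefixSum_fire {R R' : ℕ → ℤ} {i : ℕ} (hi : 1 ≤ i)
    (h : ∀ t, R' t = R t - (if t = i then 1 else 0) + (if t = i + 1 then 1 else 0)) (k : ℕ) :
    prefixSum R' k = prefixSum R k - if k = i then 1 else 0 := by
  induction k with
  | zero => simp [prefixSum_zero, show 0 ≠ i by omega]
  | succ k ih =>
    rw [prefixSum_succ, prefixSum_succ, ih, h]
    split_ifs <;> omega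

theorem PFire.decreasing_s14 {k : ℕ} {R R' : ℕ → ℤ} (h : PFire k R R') (hR : PDecreasing k R) :
    PDecreasing k R' := by
  obtain ⟨i, hi, hik, hle, heq⟩ := h.exists_right hR
  intro t ht htk
  have := hR t ht htk
  rw [heq, heq]
  split_ifs <;> subst_vars <;> omega

theorem PFire.le_of_le {k : ℕ} {R R' : ℕ → ℤ} (h : PFire k R R') {c : ℤ}
    (hR : ∀ i, R i ≤ c) (i : ℕ) : R' i ≤ c := by
  obtain ⟨a, b, -, -, -, -, -, hle, rfl⟩ := h
  have := hR i
  have := hR a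
  simp only [Function.update_apply]
  split_ifs <;> omega

theorem PFire.prefixSum_total {k : ℕ} {R R' : ℕ → ℤ} (h : PFire k R R')
    (hR : PDecreasing k R) : prefixSum R' k = prefixSum R k := by
  obtain ⟨i, hi, hik, hle, heq⟩ := h.exists_right hR
  simp [prefixSum_fire hi heq, show k ≠ i by omega]

/-- A lower barrier for the prefix sums which is nowhere too concave cannot be crossed by firing. -/
theorem PFire.barrier_le {k : ℕ} {R R' : ℕ → ℤ} {V : ℕ → ℤ} (h : PFire k R R')
    (hR : PDecreasing k R)
    (hV : ∀ t, t + 2 ≤ k → 2 * V (t + 1) - V t - V (t + 2) ≤ 1)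
    (hVR : ∀ t ≤ k, V t ≤ prefixSum R t) : ∀ t ≤ k, V t ≤ prefixSum R' t := by
  obtain ⟨i, hi, hik, hle, heq⟩ := h.exists_right hR
  intro t ht
  have htV := hVR t ht
  rw [prefixSum_fire hi heq]
  split_ifs with hti
  · subst hti
    obtain ⟨s, rfl⟩ : ∃ s, t = s + 1 := ⟨t - 1, by omega⟩
    have h₀ := hVR s (by omega)
    have h₂ := hVR (s + 2) hik
    have := hV s hik
    have := prefixSum_succ R s
    have := prefixSum_succ R (s + 1)
    simp only [add_assoc, Nat.reduceAdd] at *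
    omega
  · omega

theorem PReaches.decreasing_s14 {k : ℕ} {R R' : ℕ → ℤ} (h : PReaches k R R')
    (hR : PDecreasing k R) : PDecreasing k R' := by
  induction h with
  | refl => exact hR
  | tail _ hf ih => exact hf.decreasing_s14 ih

theorem PReaches.le_of_le {k : ℕ} {R R' : ℕ → ℤ} (h : PReaches k R R') {c : ℤ}
    (hR : ∀ i, R i ≤ c) : ∀ i, R' i ≤ c := by
  induction h with
  | refl => exact hR
  | tail _ hf ih => exact hf.le_of_le ih

theorem PReaches.prefixSum_total {k : ℕ} {R R' : ℕ → ℤ} (h : PReaches k R R')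
    (hR : PDecreasing k R) : prefixSum R' k = prefixSum R k := by
  induction h with
  | refl => rfl
  | tail hr hf ih => exact (hf.prefixSum_total (PReaches.decreasing_s14 hr hR)).trans ih

theorem PReaches.barrier_le {k : ℕ} {R R' : ℕ → ℤ} {V : ℕ → ℤ} (h : PReaches k R R')
    (hR : PDecreasing k R)
    (hV : ∀ t, t + 2 ≤ k → 2 * V (t + 1) - V t - V (t + 2) ≤ 1)
    (hVR : ∀ t ≤ k, V t ≤ prefixSum R t) : ∀ t ≤ k, V t ≤ prefixSum R' t := by
  induction h with
  | refl => exact hVR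
  | tail hr hf ih => exact hf.barrier_le (PReaches.decreasing_s14 hr hR) hV ih

theorem PStable.le_succ_add_one {k : ℕ} {R : ℕ → ℤ} (h : PStable k R) {i : ℕ} (hi : 1 ≤ i)
    (hik : i + 1 ≤ k) : R i ≤ R (i + 1) + 1 := by
  by_contra! hlt
  exact h _ ⟨i, i + 1, hi, by omega, by omega, hik, Or.inr rfl, by omega, rfl⟩

theorem Rinit_decreasing (n ℓ k : ℕ) : PDecreasing k (Rinit n ℓ) := by
  intro i hi _
  simp only [Rinit]
  split_ifs <;> omega

theorem Rinit_le (n ℓ i : ℕ) : Rinit n ℓ i ≤ n := by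
  simp only [Rinit]
  split_ifs <;> omega

theorem prefixSum_Rinit (n ℓ k : ℕ) : prefixSum (Rinit n ℓ) k = n * (min k ℓ : ℕ) := by
  induction k with
  | zero => simp [prefixSum_zero]
  | succ k ih =>
    rw [prefixSum_succ, ih, Rinit]
    split_ifs with h
    · rw [min_eq_left (by omega), min_eq_left (by omega)]
      push_cast
      ring
    · rw [min_eq_right (by omega), min_eq_right (by omega), add_zero]

theorem prefixSum_le_of_le {R : ℕ → ℤ} {c : ℤ} (hc : ∀ i, R i ≤ c) (k : ℕ) :
    prefixSum R k ≤ c * k := by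
  induction k with
  | zero => simp [prefixSum_zero]
  | succ k ih =>
    rw [prefixSum_succ]
    push_cast
    linarith [hc (k + 1)]

/-- The number of firings across the edge `(t, t + 1)` in an unobstructed stabilization. -/
def tentOdometer (m ℓ t : ℕ) : ℤ :=
  ((if t ≤ ℓ then t + m - ℓ else ℓ + m - t) + 1).choose 2

theorem choose_two_succ (a : ℕ) : (((a + 1 + 1).choose 2 : ℕ) : ℤ) = (a + 1).choose 2 + a + 1 := by
  rw [Nat.choose_succ_succ' (a + 1) 1, Nat.choose_one_right]
  push_cast
  ring

theorem tentOdometer_second_difference {n m ℓ t : ℕ} (hn : n ≤ 2 * m + 1) (hm : 1 ≤ m)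
    (ht : t + 2 ≤ ℓ + m) :
    2 * ((n : ℤ) * (min (t + 1) ℓ : ℕ) - tentOdometer m ℓ (t + 1))
      - ((n : ℤ) * (min t ℓ : ℕ) - tentOdometer m ℓ t)
      - ((n : ℤ) * (min (t + 2) ℓ : ℕ) - tentOdometer m ℓ (t + 2)) ≤ 1 := by
  unfold tentOdometer
  rcases lt_trichotomy (t + 1) ℓ with h | h | h
  · rw [min_eq_left (by omega), min_eq_left (by omega), min_eq_left (by omega),
      if_pos (by omega), if_pos (by omega), if_pos (by omega)]
    by_cases hs : ℓ ≤ t + m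
    · obtain ⟨a, ha⟩ := Nat.exists_eq_add_of_le hs
      rw [show t + m - ℓ = a by omega, show t + 1 + m - ℓ = a + 1 by omega,
        show t + 2 + m - ℓ = a + 1 + 1 by omega, choose_two_succ (a + 1), choose_two_succ a]
      push_cast
      linarith
    · rw [show t + m - ℓ = 0 by omega, show t + 1 + m - ℓ = 0 by omega]
      have : ((t + 2 + m - ℓ + 1).choose 2 : ℤ) ≤ 1 := by
        obtain h | h : t + 2 + m - ℓ = 0 ∨ t + 2 + m - ℓ = 1 := by omega
        all_goals simp [h]
      push_cast
      simp
      linarith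
  · obtain ⟨a, rfl⟩ : ∃ a, m = a + 1 := ⟨m - 1, by omega⟩
    subst h
    rw [min_eq_left (by omega), min_eq_left (by omega), min_eq_right (by omega),
      if_pos (by omega), if_pos (by omega), if_neg (by omega),
      show t + (a + 1) - (t + 1) = a by omega, show t + 1 + (a + 1) - (t + 1) = a + 1 by omega,
      show t + 1 + (a + 1) - (t + 2) = a by omega, choose_two_succ a]
    have : (n : ℤ) ≤ 2 * (a + 1) + 1 := by exact_mod_cast hn
    push_cast
    linarith
  · obtain ⟨a, ha⟩ := Nat.exists_eq_add_of_le ht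
    have ht₀ : (if t ≤ ℓ then t + m - ℓ else ℓ + m - t) = a + 1 + 1 := by
      split_ifs <;> omega
    rw [min_eq_right (by omega), min_eq_right (by omega), min_eq_right (by omega),
      ht₀, if_neg (by omega), if_neg (by omega),
      show ℓ + m - (t + 1) = a + 1 by omega, show ℓ + m - (t + 2) = a by omega,
      choose_two_succ (a + 1), choose_two_succ a]
    push_cast
    linarith

theorem PReaches.eq_of_le_sub_half {n m ℓ i : ℕ} {R : ℕ → ℤ} (hn : n ≤ 2 * m + 1) (hm : 1 ≤ m)
    (h : PReaches (ℓ + m) (Rinit n ℓ) R) (hi : 1 ≤ i) (him : i + m ≤ ℓ) : R i = n := by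
  have hdec := Rinit_decreasing n ℓ (ℓ + m)
  have hV := PReaches.barrier_le
    (V := fun t => (n : ℤ) * (min t ℓ : ℕ) - tentOdometer m ℓ t) h hdec
    (fun t ht => tentOdometer_second_difference hn hm ht)
    (fun t _ => by
      have : 0 ≤ tentOdometer m ℓ t := Int.natCast_nonneg _
      rw [prefixSum_Rinit]
      linarith) i (by omega)
  have hle := PReaches.le_of_le h (Rinit_le n ℓ)
  obtain ⟨j, rfl⟩ : ∃ j, i = j + 1 := ⟨i - 1, by omega⟩
  have htent : tentOdometer m ℓ (j + 1) = 0 := by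
    simp [tentOdometer, show j + 1 ≤ ℓ by omega, show j + 1 + m - ℓ = 0 by omega]
  simp only [htent, min_eq_left (show j + 1 ≤ ℓ by omega), prefixSum_succ] at hV
  have := prefixSum_le_of_le hle j
  refine le_antisymm (hle _) ?_
  push_cast at hV
  linarith

theorem le_prefixSum_of_stable {k i : ℕ} {R : ℕ → ℤ} (hs : PStable k R) (hd : PDecreasing k R)
    (hi : 1 ≤ i) (t : ℕ) (ht : i + t ≤ k) :
    R i - t ≤ R (i + t) ∧ 2 * R i * (i + t) - t * (t + 1) ≤ 2 * prefixSum R (i + t) := by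
  induction t with
  | zero =>
    have hj : ∀ j ≤ i, R i * j ≤ prefixSum R j := by
      intro j hj
      induction j with
      | zero => simp [prefixSum_zero]
      | succ j ih =>
        have := ih (by omega)
        have := hd.le (Nat.le_add_left 1 j) hj (by omega)
        rw [prefixSum_succ]
        push_cast
        linarith
    have := hj i le_rfl
    simp
    linarith
  | succ t ih =>
    obtain ⟨h₁, h₂⟩ := ih (by omega)
    have := hs.le_succ_add_one (i := i + t) (by omega) ht
    rw [← add_assoc, prefixSum_succ]
    push_cast
    constructor <;> nlinarith


theorem value_n_iff_never_fired
    (n ℓ : ℕ) (hn : 2 ≤ n) (hℓ : 1 ≤ ℓ)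
    (R' : ℕ → ℤ) (hreach : PReaches (pathLen n ℓ) (Rinit n ℓ) R')
    (hstable : PStable (pathLen n ℓ) R') :
    ∀ i : ℕ, 1 ≤ i → i ≤ pathLen n ℓ →
      (R' i = (n : ℤ) ↔ (i : ℤ) ≤ (ℓ : ℤ) - (n / 2 : ℕ)) := by
  intro i hi hik
  have hlen : pathLen n ℓ = ℓ + n / 2 := by unfold pathLen; omega
  rw [hlen] at hreach hstable hik
  have hm : 1 ≤ n / 2 := by omega
  have hn₂ : 2 * (n / 2) ≤ n := by omega
  have hn₁ : n ≤ 2 * (n / 2) + 1 := by omega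
  generalize n / 2 = m at *
  refine ⟨fun hRi => ?_, fun h => hreach.eq_of_le_sub_half hn₁ hm hi (by omega)⟩
  by_contra! hlt
  have hdec := Rinit_decreasing n ℓ (ℓ + m)
  obtain ⟨t, ht⟩ := Nat.exists_eq_add_of_le hik
  have hsum := (le_prefixSum_of_stable hstable (hreach.decreasing_s14 hdec) hi t ht.ge).2
  rw [← ht, hreach.prefixSum_total hdec, prefixSum_Rinit, min_eq_right (by omega), hRi] at hsum
  have htm : (t : ℤ) ≤ 2 * m - 1 := by omega
  have hit : (i : ℤ) + t = ℓ + m := by exact_mod_cast ht.symm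
  have htt : (t : ℤ) * (t + 1) ≤ (2 * m - 1) * (2 * m) :=
    mul_le_mul htm (by linarith) (by positivity) (by omega)
  rw [hit] at hsum
  have hmn : (2 * m : ℤ) * (2 * m) ≤ 2 * m * n := by
    gcongr
    exact_mod_cast hn₂
  have : (1 : ℤ) ≤ m := by exact_mod_cast hm
  nlinarith
end

section
/- Let n, ℓ ∈ ℕ with ℓ ≥ 1. Then path-firing on R(ℓ) terminates uniquely: every sequence of path-firing moves starting from R(ℓ) is finite, and any two path-stable configurations reachable from R(ℓ) are equal. -/
/-- Moving one unit from position `i` to position `i + 1`. -/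
def fireRight (i : ℕ) (R : ℕ → ℤ) : ℕ → ℤ :=
  fun x => if x = i then R x - 1 else if x = i + 1 then R x + 1 else R x

/-- The configuration is weakly decreasing on the positions `1,…,k`. -/
def WeaklyDecreasing (k : ℕ) (R : ℕ → ℤ) : Prop :=
  ∀ i, 1 ≤ i → i + 1 ≤ k → R (i + 1) ≤ R i

theorem pFire_fireRight {k i : ℕ} {R : ℕ → ℤ} (hi : 1 ≤ i) (hik : i + 1 ≤ k)
    (h : R (i + 1) + 2 ≤ R i) : PFire k R (fireRight i R) := by
  refine ⟨i, i + 1, hi, by omega, by omega, hik, Or.inr rfl, h, ?_⟩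
  funext x
  simp only [fireRight, Function.update_apply]
  grind

theorem PFire.exists_fireRight {k : ℕ} {R R' : ℕ → ℤ} (hR : WeaklyDecreasing k R)
    (h : PFire k R R') :
    ∃ i, 1 ≤ i ∧ i + 1 ≤ k ∧ R (i + 1) + 2 ≤ R i ∧ R' = fireRight i R := by
  obtain ⟨i, j, hi, hik, hj, hjk, rfl | rfl, hlt, rfl⟩ := h
  · have := hR j hj hik
    omega
  · refine ⟨i, hi, hjk, hlt, ?_⟩
    funext x
    simp only [fireRight, Function.update_apply]
    grind

theorem WeaklyDecreasing.fireRight {k i : ℕ} {R : ℕ → ℤ} (hR : WeaklyDecreasing k R)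
    (h : R (i + 1) + 2 ≤ R i) : WeaklyDecreasing k (fireRight i R) := by
  intro j hj hjk
  have := hR j hj hjk
  simp only [_root_.fireRight]
  grind

theorem fireRight_comm (i j : ℕ) (R : ℕ → ℤ) :
    fireRight i (fireRight j R) = fireRight j (fireRight i R) := by
  funext x
  simp only [fireRight]
  grind

theorem fireRight_slope {i j : ℕ} {R : ℕ → ℤ} (hij : i ≠ j) (h : R (j + 1) + 2 ≤ R j) :
    fireRight i R (j + 1) + 2 ≤ fireRight i R j := by
  simp only [fireRight]
  grind

/-- Two moves from a weakly decreasing configuration can be completed to a square. -/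
theorem pFire_diamond {k : ℕ} {R S T : ℕ → ℤ} (hR : WeaklyDecreasing k R)
    (hS : PFire k R S) (hT : PFire k R T) :
    S = T ∨ ∃ U, PFire k S U ∧ PFire k T U := by
  obtain ⟨i, hi, hik, hlt, rfl⟩ := hS.exists_fireRight hR
  obtain ⟨j, hj, hjk, hlt', rfl⟩ := hT.exists_fireRight hR
  rcases eq_or_ne i j with rfl | hij
  · exact Or.inl rfl
  · refine Or.inr ⟨fireRight j (fireRight i R),
      pFire_fireRight hj hjk (fireRight_slope hij hlt'), ?_⟩
    rw [fireRight_comm]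
    exact pFire_fireRight hi hik (fireRight_slope hij.symm hlt)

theorem WeaklyDecreasing.of_pFire {k : ℕ} {R S : ℕ → ℤ} (hR : WeaklyDecreasing k R)
    (h : PFire k R S) : WeaklyDecreasing k S := by
  obtain ⟨i, -, -, hlt, rfl⟩ := h.exists_fireRight hR
  exact hR.fireRight hlt

theorem PReaches.restrict {k : ℕ} {R S : ℕ → ℤ} (hR : WeaklyDecreasing k R)
    (h : PReaches k R S) :
    WeaklyDecreasing k S ∧
      Relation.ReflTransGen (fun A B => WeaklyDecreasing k A ∧ PFire k A B) R S := by
  induction h with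
  | refl => exact ⟨hR, .refl⟩
  | tail _ hbc ih => exact ⟨ih.1.of_pFire hbc, ih.2.tail ⟨ih.1, hbc⟩⟩

theorem PStable.eq_of_reaches {k : ℕ} {R S T : ℕ → ℤ} (hR : WeaklyDecreasing k R)
    (hS : PReaches k R S) (hS' : PStable k S) (hT : PReaches k R T) (hT' : PStable k T) :
    S = T := by
  obtain ⟨U, hSU, hTU⟩ := Relation.church_rosser
    (r := fun A B => WeaklyDecreasing k A ∧ PFire k A B)
    (fun A B C ⟨hA, hB⟩ ⟨_, hC⟩ => by
      rcases pFire_diamond hA hB hC with rfl | ⟨U, hBU, hCU⟩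
      · exact ⟨B, .refl, .refl⟩
      · exact ⟨U, .single ⟨hA.of_pFire hB, hBU⟩, .single ⟨hA.of_pFire hC, hCU⟩⟩)
    (hS.restrict hR).2 (hT.restrict hR).2
  have eq_of_stable : ∀ {A : ℕ → ℤ}, PStable k A →
      Relation.ReflTransGen (fun A B => WeaklyDecreasing k A ∧ PFire k A B) A U → A = U := by
    intro A hA h
    rcases h.cases_head with h | ⟨B, hB, -⟩
    · exact h
    · exact absurd hB.2 (hA B)
  rw [eq_of_stable hS' hSU, eq_of_stable hT' hTU]

theorem PFire.sum_sq_lt {k : ℕ} {R S : ℕ → ℤ} (h : PFire k R S) :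
    ∑ x ∈ Finset.Icc 1 k, S x ^ 2 < ∑ x ∈ Finset.Icc 1 k, R x ^ 2 := by
  obtain ⟨i, j, hi, hik, hj, hjk, hij, hlt, rfl⟩ := h
  have hne : i ≠ j := by omega
  have hi' : i ∈ (Finset.Icc 1 k).erase j := by simp [*]
  have hj' : j ∈ Finset.Icc 1 k := by simp [*]
  rw [← Finset.add_sum_erase _ _ hj', ← Finset.add_sum_erase _ _ hi',
    ← Finset.add_sum_erase _ (fun x => R x ^ 2) hj',
    ← Finset.add_sum_erase _ (fun x => R x ^ 2) hi']
  have hrest : ∑ x ∈ ((Finset.Icc 1 k).erase j).erase i,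
      Function.update (Function.update R i (R i - 1)) j (R j + 1) x ^ 2 =
      ∑ x ∈ ((Finset.Icc 1 k).erase j).erase i, R x ^ 2 := by
    refine Finset.sum_congr rfl fun x hx => ?_
    simp only [Finset.mem_erase] at hx
    rw [Function.update_of_ne hx.2.1, Function.update_of_ne hx.1]
  rw [hrest, Function.update_self, Function.update_of_ne hne, Function.update_self]
  nlinarith

theorem not_exists_infinite_pFire (k : ℕ) :
    ¬ ∃ seq : ℕ → ℕ → ℤ, ∀ t : ℕ, PFire k (seq t) (seq (t + 1)) := by
  rintro ⟨seq, hseq⟩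
  refine not_strictAnti_of_wellFoundedLT
    (fun t => (∑ x ∈ Finset.Icc 1 k, seq t x ^ 2).toNat) (strictAnti_nat_of_succ_lt fun t => ?_)
  have hlt := (hseq t).sum_sq_lt
  have hnonneg : 0 ≤ ∑ x ∈ Finset.Icc 1 k, seq (t + 1) x ^ 2 :=
    Finset.sum_nonneg fun x _ => sq_nonneg _
  omega

theorem weaklyDecreasing_Rinit (k n ℓ : ℕ) : WeaklyDecreasing k (Rinit n ℓ) := by
  intro i hi _
  simp only [Rinit]
  split_ifs <;> omega

theorem path_firing_confluent (n ℓ : ℕ) (hℓ : 1 ≤ ℓ) :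
    (¬ ∃ seq : ℕ → ℕ → ℤ, seq 0 = Rinit n ℓ ∧
        ∀ t : ℕ, PFire (pathLen n ℓ) (seq t) (seq (t + 1))) ∧
    (∀ R₁ R₂ : ℕ → ℤ,
      PReaches (pathLen n ℓ) (Rinit n ℓ) R₁ → PStable (pathLen n ℓ) R₁ →
      PReaches (pathLen n ℓ) (Rinit n ℓ) R₂ → PStable (pathLen n ℓ) R₂ →
      R₁ = R₂) := by
  exact ⟨fun ⟨seq, _, hseq⟩ => not_exists_infinite_pFire _ ⟨seq, hseq⟩,
    fun _ _ h₁ hs₁ h₂ hs₂ => PStable.eq_of_reaches (weaklyDecreasing_Rinit _ n ℓ) h₁ hs₁ h₂ hs₂⟩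
end
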